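/- Fix α ∈ [0,1) and let a, b : (0,∞) → ℝ be differentiable. With h_{kl}(x) = b(|x|) h^α_{kl}(x) + (a(|x|) − b(|x|)) x_k x_l/|x|², h^{α ij}(x) = (1/(1−α))(δ_{ij} − α x_i x_j/|x|²), and ∇^α_j h_{kl} the covariant derivative of h with respect to the Christoffel symbols Γ^m_{jk}(x) = (α/|x|²)(δ_{jk} x_m − x_m x_j x_k/|x|²), define T^i(x) = Σ_{j,k,l} (h^{α ik}(x) h^{α jl}(x) − h^{α ij}(x) h^{α kl}(x)) ∇^α_j h_{kl}(x). Then for every x ∈ ℝ³ \ {0}: Σ_i T^i(x) x_i/|x| = −2 b'(|x|) + 2 (a(|x|) − b(|x|))/|x|. -/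

import Mathlib

noncomputable section

/-- Kronecker delta on `Fin 3`. -/
def kron (i j : Fin 3) : ℝ := if i = j then 1 else 0

/-- h^α_{ij}(x) = (1−α)δ_{ij} + α x_i x_j/|x|². -/
def halpha (α : ℝ) (x : EuclideanSpace ℝ (Fin 3)) (i j : Fin 3) : ℝ :=
  (1 - α) * kron i j + α * x i * x j / ‖x‖^2

/-- Inverse of h^α: h^{α ij}(x) = (1/(1−α))(δ_{ij} − α x_i x_j/|x|²). -/
def halphaInv (α : ℝ) (x : EuclideanSpace ℝ (Fin 3)) (i j : Fin 3) : ℝ :=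
  (1/(1-α)) * (kron i j - α * x i * x j / ‖x‖^2)

/-- Christoffel symbols of h^α: Γ^m_{jk}(x) = (α/|x|²)(δ_{jk} x_m − x_m x_j x_k/|x|²). -/
def Gammaalpha (α : ℝ) (x : EuclideanSpace ℝ (Fin 3)) (m j k : Fin 3) : ℝ :=
  (α/‖x‖^2) * (kron j k * x m - x m * x j * x k / ‖x‖^2)

/-- Cartesian expression of the spherically symmetric metric:
h_{kl}(x) = b(|x|)h^α_{kl}(x) + (a(|x|)−b(|x|)) x_k x_l/|x|². -/
def hmet (α : ℝ) (a b : ℝ → ℝ) (x : EuclideanSpace ℝ (Fin 3)) (k l : Fin 3) : ℝ :=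
  b ‖x‖ * halpha α x k l + (a ‖x‖ - b ‖x‖) * x k * x l / ‖x‖^2

/-- The j-th partial derivative of a function on ℝ³. -/
def pd (j : Fin 3) (f : EuclideanSpace ℝ (Fin 3) → ℝ) (x : EuclideanSpace ℝ (Fin 3)) : ℝ :=
  fderiv ℝ f x (EuclideanSpace.single j 1)

/-- Covariant derivative ∇^α_j h_{kl} of h with respect to h^α. -/
def nablah (α : ℝ) (a b : ℝ → ℝ) (x : EuclideanSpace ℝ (Fin 3)) (j k l : Fin 3) : ℝ :=
  pd j (fun y => hmet α a b y k l) x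
    - (∑ m : Fin 3, Gammaalpha α x m j k * hmet α a b x m l)
    - (∑ m : Fin 3, Gammaalpha α x m j l * hmet α a b x m k)

/-- The vector T^i(x) = Σ_{j,k,l}(h^{α ik}h^{α jl} − h^{α ij}h^{α kl})∇^α_j h_{kl}. -/
def Tvec (α : ℝ) (a b : ℝ → ℝ) (x : EuclideanSpace ℝ (Fin 3)) (i : Fin 3) : ℝ :=
  ∑ j : Fin 3, ∑ k : Fin 3, ∑ l : Fin 3,
    (halphaInv α x i k * halphaInv α x j l - halphaInv α x i j * halphaInv α x k l)
      * nablah α a b x j k l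

lemma sum_kron_mul (j : Fin 3) (f : Fin 3 → ℝ) : ∑ k, kron j k * f k = f j := by
  simp [kron]

lemma kron_comm (i j : Fin 3) : kron i j = kron j i := by
  simp [kron, eq_comm]

lemma sum_coord_sq (x : EuclideanSpace ℝ (Fin 3)) : ∑ k, x k * x k = ‖x‖ ^ 2 := by
  simp [EuclideanSpace.real_norm_sq_eq, ← sq]

/-- A coordinate function is its own derivative. -/
lemma hasFDerivAt_coord (x : EuclideanSpace ℝ (Fin 3)) (k : Fin 3) :
    HasFDerivAt (fun y : EuclideanSpace ℝ (Fin 3) => y k)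
      (EuclideanSpace.proj k : EuclideanSpace ℝ (Fin 3) →L[ℝ] ℝ) x :=
  (EuclideanSpace.proj k : EuclideanSpace ℝ (Fin 3) →L[ℝ] ℝ).hasFDerivAt

/-- The Euclidean norm is differentiable away from the origin, with radial gradient. -/
lemma hasFDerivAt_norm_of_ne {x : EuclideanSpace ℝ (Fin 3)} (hx : x ≠ 0) :
    HasFDerivAt (fun y : EuclideanSpace ℝ (Fin 3) => ‖y‖) (‖x‖⁻¹ • innerSL ℝ x) x := by
  have hr : ‖x‖ ≠ 0 := norm_ne_zero_iff.2 hx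
  have h := (hasStrictFDerivAt_norm_sq x).hasFDerivAt.sqrt (pow_ne_zero 2 hr)
  simp only [Real.sqrt_sq (norm_nonneg _)] at h
  rw [← Nat.cast_smul_eq_nsmul ℝ, smul_smul] at h
  have hc : 1 / (2 * ‖x‖) * ((2 : ℕ) : ℝ) = ‖x‖⁻¹ := by
    push_cast
    field_simp
  rwa [hc] at h

/-- The partial derivatives of `b(|x|) h^α_{kl} + (a(|x|) - b(|x|)) x_k x_l / |x|²`. -/
lemma pd_hmet (α : ℝ) {a b : ℝ → ℝ} {x : EuclideanSpace ℝ (Fin 3)} (hx : x ≠ 0)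
    (ha : DifferentiableAt ℝ a ‖x‖) (hb : DifferentiableAt ℝ b ‖x‖) (j k l : Fin 3) :
    pd j (fun y => hmet α a b y k l) x
      = deriv b ‖x‖ * x j / ‖x‖ * halpha α x k l
        + (deriv a ‖x‖ - deriv b ‖x‖) * x j * x k * x l / ‖x‖ ^ 3
        + (α * b ‖x‖ + a ‖x‖ - b ‖x‖) *
          ((kron j k * x l + kron j l * x k) / ‖x‖ ^ 2 - 2 * x j * x k * x l / ‖x‖ ^ 4) := by
  have hr : ‖x‖ ≠ 0 := norm_ne_zero_iff.2 hx
  have hn := hasFDerivAt_norm_of_ne hx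
  have hA := ha.hasDerivAt.comp_hasFDerivAt x hn
  have hB := hb.hasDerivAt.comp_hasFDerivAt x hn
  have hk := hasFDerivAt_coord x k
  have hl := hasFDerivAt_coord x l
  have hinv := (hasDerivAt_inv (pow_ne_zero 2 hr)).comp_hasFDerivAt x (hn.pow 2)
  have h := (hB.mul ((((hk.const_mul α).mul hl).mul hinv).const_add ((1 - α) * kron k l))).add
    ((((hA.sub hB).mul hk).mul hl).mul hinv)
  have h' := h.congr_of_eventuallyEq (f₁ := fun y => hmet α a b y k l)
    (Filter.Eventually.of_forall fun y => by simp [hmet, halpha, div_eq_mul_inv])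
  have hj : ∀ m : Fin 3, (EuclideanSpace.single j (1 : ℝ)) m = kron j m := by
    intro m; simp [kron, eq_comm]
  have hin : inner ℝ x (EuclideanSpace.single j (1 : ℝ)) = x j := by
    simp [EuclideanSpace.inner_single_right]
  rw [pd, h'.fderiv]
  generalize EuclideanSpace.single j (1 : ℝ) = e at hj hin ⊢
  simp [hj, hin, halpha]
  field_simp
  ring

lemma sum_coord_mul_hmet (α : ℝ) (a b : ℝ → ℝ) {x : EuclideanSpace ℝ (Fin 3)} (hx : x ≠ 0)
    (l : Fin 3) : ∑ m, x m * hmet α a b x m l = a ‖x‖ * x l := by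
  have hr : ‖x‖ ≠ 0 := norm_ne_zero_iff.2 hx
  have h1 := sum_kron_mul l (fun k => x k)
  have h2 := sum_coord_sq x
  simp only [hmet, halpha, kron_comm _ l, Fin.sum_univ_three] at *
  field_simp
  linear_combination (b ‖x‖ * (1 - α) * ‖x‖ ^ 2) * h1
    + (b ‖x‖ * α + a ‖x‖ - b ‖x‖) * x l * h2

/-- The contraction of the Christoffel symbols with the metric. -/
lemma sum_Gammaalpha_mul_hmet (α : ℝ) (a b : ℝ → ℝ) {x : EuclideanSpace ℝ (Fin 3)} (hx : x ≠ 0)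
    (j k l : Fin 3) : ∑ m, Gammaalpha α x m j k * hmet α a b x m l
      = α / ‖x‖ ^ 2 * (kron j k - x j * x k / ‖x‖ ^ 2) * (a ‖x‖ * x l) := by
  rw [← sum_coord_mul_hmet α a b hx l, Finset.mul_sum]
  refine Finset.sum_congr rfl fun m _ => ?_
  rw [Gammaalpha]
  ring

/-- Since `h^α` is parallel, only the radial profiles and the Hessian of `|x|` contribute. -/
lemma nablah_eq (α : ℝ) {a b : ℝ → ℝ} {x : EuclideanSpace ℝ (Fin 3)} (hx : x ≠ 0)
    (ha : DifferentiableAt ℝ a ‖x‖) (hb : DifferentiableAt ℝ b ‖x‖) (j k l : Fin 3) :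
    nablah α a b x j k l
      = deriv b ‖x‖ * x j / ‖x‖ * halpha α x k l
        + (deriv a ‖x‖ - deriv b ‖x‖) * x j * x k * x l / ‖x‖ ^ 3
        + (1 - α) * (a ‖x‖ - b ‖x‖) / ‖x‖ ^ 2 *
          ((kron j k - x j * x k / ‖x‖ ^ 2) * x l + (kron j l - x j * x l / ‖x‖ ^ 2) * x k) := by
  have hr : ‖x‖ ≠ 0 := norm_ne_zero_iff.2 hx
  rw [nablah, pd_hmet α hx ha hb, sum_Gammaalpha_mul_hmet α a b hx,
    sum_Gammaalpha_mul_hmet α a b hx]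
  field_simp
  ring

lemma sum_halphaInv_mul_coord {α : ℝ} (hα : 1 - α ≠ 0) {x : EuclideanSpace ℝ (Fin 3)}
    (hx : x ≠ 0) (k : Fin 3) : ∑ i, halphaInv α x i k * x i = x k := by
  have hr : ‖x‖ ≠ 0 := norm_ne_zero_iff.2 hx
  have h1 := sum_kron_mul k (fun i => x i)
  have h2 := sum_coord_sq x
  simp only [halphaInv, kron_comm _ k, Fin.sum_univ_three] at *
  field_simp
  linear_combination ‖x‖ ^ 2 * h1 - α * x k * h2

lemma sum_coord_mul_halpha (α : ℝ) {x : EuclideanSpace ℝ (Fin 3)}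
    (hx : x ≠ 0) (l : Fin 3) : ∑ k, x k * halpha α x k l = x l := by
  simpa [hmet] using sum_coord_mul_hmet α (fun _ => 1) (fun _ => 1) hx l

lemma sum_halphaInv_mul_coord_mul_coord {α : ℝ} (hα : 1 - α ≠ 0)
    {x : EuclideanSpace ℝ (Fin 3)} (hx : x ≠ 0) :
    ∑ j, ∑ l, halphaInv α x j l * (x j * x l) = ‖x‖ ^ 2 := by
  rw [Finset.sum_comm, ← sum_coord_sq]
  refine Finset.sum_congr rfl fun l _ => ?_
  nth_rw 3 [← sum_halphaInv_mul_coord hα hx l]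
  rw [Finset.mul_sum]
  exact Finset.sum_congr rfl fun j _ => by ring

lemma sum_halphaInv_mul_kron {α : ℝ} (hα : 1 - α ≠ 0)
    {x : EuclideanSpace ℝ (Fin 3)} (hx : x ≠ 0) :
    ∑ j, ∑ l, halphaInv α x j l * kron j l = (3 - α) / (1 - α) := by
  have hr : ‖x‖ ≠ 0 := norm_ne_zero_iff.2 hx
  have h2 := sum_coord_sq x
  simp only [halphaInv, kron, Fin.sum_univ_three] at *
  simp
  field_simp
  linear_combination - α * h2

lemma sum_halphaInv_mul_halpha {α : ℝ} (hα : 1 - α ≠ 0)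
    {x : EuclideanSpace ℝ (Fin 3)} (hx : x ≠ 0) :
    ∑ j, ∑ l, halphaInv α x j l * halpha α x j l = 3 := by
  have hr : ‖x‖ ≠ 0 := norm_ne_zero_iff.2 hx
  have h : ∀ j l, halphaInv α x j l * halpha α x j l
      = (1 - α) * (halphaInv α x j l * kron j l)
        + α / ‖x‖ ^ 2 * (halphaInv α x j l * (x j * x l)) := fun j l => by
    rw [halpha]; ring
  simp only [h, Finset.sum_add_distrib, ← Finset.mul_sum, sum_halphaInv_mul_kron hα hx,
    sum_halphaInv_mul_coord_mul_coord hα hx]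
  field_simp
  ring

/-- Contraction of `∇^α_j h_{kl}` with `x_k`. -/
lemma sum_coord_mul_nablah_snd (α : ℝ) {a b : ℝ → ℝ} {x : EuclideanSpace ℝ (Fin 3)} (hx : x ≠ 0)
    (ha : DifferentiableAt ℝ a ‖x‖) (hb : DifferentiableAt ℝ b ‖x‖) (j l : Fin 3) :
    ∑ k, x k * nablah α a b x j k l
      = (deriv a ‖x‖ / ‖x‖ - (1 - α) * (a ‖x‖ - b ‖x‖) / ‖x‖ ^ 2) * (x j * x l)
        + (1 - α) * (a ‖x‖ - b ‖x‖) * kron j l := by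
  have hr : ‖x‖ ≠ 0 := norm_ne_zero_iff.2 hx
  have h1 := sum_kron_mul j (fun k => x k)
  have h2 := sum_coord_sq x
  have h3 := sum_coord_mul_halpha α hx l
  simp only [nablah_eq α hx ha hb, Fin.sum_univ_three] at *
  generalize halpha α x 0 l = p0 at *
  generalize halpha α x 1 l = p1 at *
  generalize halpha α x 2 l = p2 at *
  field_simp
  linear_combination (deriv b ‖x‖ * x j * ‖x‖ ^ 3) * h3
    + ((deriv a ‖x‖ - deriv b ‖x‖) * x j * x l * ‖x‖
       + (1 - α) * (a ‖x‖ - b ‖x‖) * (kron j l * ‖x‖ ^ 2 - 2 * x j * x l)) * h2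
    + ((1 - α) * (a ‖x‖ - b ‖x‖) * x l * ‖x‖ ^ 2) * h1

/-- Contraction of `∇^α_j h_{kl}` with `x_j`. -/
lemma sum_coord_mul_nablah_fst (α : ℝ) {a b : ℝ → ℝ} {x : EuclideanSpace ℝ (Fin 3)} (hx : x ≠ 0)
    (ha : DifferentiableAt ℝ a ‖x‖) (hb : DifferentiableAt ℝ b ‖x‖) (k l : Fin 3) :
    ∑ j, x j * nablah α a b x j k l
      = deriv b ‖x‖ * ‖x‖ * halpha α x k l
        + (deriv a ‖x‖ - deriv b ‖x‖) / ‖x‖ * (x k * x l) := by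
  have hr : ‖x‖ ≠ 0 := norm_ne_zero_iff.2 hx
  have h1 := sum_kron_mul k (fun j => x j)
  have h1' := sum_kron_mul l (fun j => x j)
  have h2 := sum_coord_sq x
  simp only [nablah_eq α hx ha hb, kron_comm _ k, kron_comm _ l, Fin.sum_univ_three] at *
  generalize halpha α x k l = p at *
  field_simp
  linear_combination (deriv b ‖x‖ * p * ‖x‖ ^ 3
      + (deriv a ‖x‖ - deriv b ‖x‖) * x k * x l * ‖x‖
      - (1 - α) * (a ‖x‖ - b ‖x‖) * 2 * x k * x l) * h2
    + ((1 - α) * (a ‖x‖ - b ‖x‖) * x l * ‖x‖ ^ 2) * h1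
    + ((1 - α) * (a ‖x‖ - b ‖x‖) * x k * ‖x‖ ^ 2) * h1'

/-- Contraction of `T^i` with `x_i`, using `h^{α ik} x_i = x_k`. -/
lemma sum_Tvec_mul_coord {α : ℝ} (hα : 1 - α ≠ 0) (a b : ℝ → ℝ)
    {x : EuclideanSpace ℝ (Fin 3)} (hx : x ≠ 0) :
    ∑ i, Tvec α a b x i * x i
      = ∑ j, ∑ l, halphaInv α x j l * ∑ k, x k * nablah α a b x j k l
        - ∑ k, ∑ l, halphaInv α x k l * ∑ j, x j * nablah α a b x j k l := by
  have h : ∀ v w : Fin 3 → ℝ, (∀ k, ∑ i, halphaInv α x i k * v i = w k) →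
      ∑ i, Tvec α a b x i * v i
        = ∑ j, ∑ l, halphaInv α x j l * ∑ k, w k * nablah α a b x j k l
          - ∑ k, ∑ l, halphaInv α x k l * ∑ j, w j * nablah α a b x j k l := by
    intro v w hw
    obtain rfl : (fun k => ∑ i, halphaInv α x i k * v i) = w := funext hw
    simp only [Tvec, Fin.sum_univ_three]
    ring
  exact h _ _ (sum_halphaInv_mul_coord hα hx)

/-- For every x ≠ 0,
Σ_i T^i(x) x_i/|x| = −2b'(|x|) + 2(a(|x|) − b(|x|))/|x|. -/
theorem Tvec_radial_component (α : ℝ) (hα : α ∈ Set.Ico (0:ℝ) 1)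
    (a b : ℝ → ℝ)
    (ha : ∀ r > (0:ℝ), DifferentiableAt ℝ a r)
    (hb : ∀ r > (0:ℝ), DifferentiableAt ℝ b r)
    (x : EuclideanSpace ℝ (Fin 3)) (hx : x ≠ 0) :
    ∑ i : Fin 3, Tvec α a b x i * x i / ‖x‖
      = -2 * deriv b ‖x‖ + 2 * (a ‖x‖ - b ‖x‖) / ‖x‖ := by
  have hr : ‖x‖ ≠ 0 := norm_ne_zero_iff.2 hx
  have hα' : 1 - α ≠ 0 := (sub_pos.2 hα.2).ne'
  have ha' := ha ‖x‖ (norm_pos_iff.2 hx)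
  have hb' := hb ‖x‖ (norm_pos_iff.2 hx)
  have hlin : ∀ (c d : ℝ) (f g : Fin 3 → Fin 3 → ℝ),
      ∑ j, ∑ l, halphaInv α x j l * (c * f j l + d * g j l)
        = c * ∑ j, ∑ l, halphaInv α x j l * f j l
          + d * ∑ j, ∑ l, halphaInv α x j l * g j l := fun c d f g => by
    simp only [Finset.mul_sum, ← Finset.sum_add_distrib]
    exact Finset.sum_congr rfl fun j _ => Finset.sum_congr rfl fun l _ => by ring
  rw [← Finset.sum_div, sum_Tvec_mul_coord hα' a b hx]
  simp only [sum_coord_mul_nablah_snd α hx ha' hb', sum_coord_mul_nablah_fst α hx ha' hb']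
  rw [hlin _ _ (fun j l => x j * x l) kron, hlin _ _ (halpha α x) (fun j l => x j * x l)]
  rw [sum_halphaInv_mul_halpha hα' hx, sum_halphaInv_mul_kron hα' hx,
    sum_halphaInv_mul_coord_mul_coord hα' hx]
  field_simp
  ring

end
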